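/- arXiv:1307.3084 — 3 statements merged into one kernel-verified Lean document; each statement's English description precedes it below -/
import Mathlib

section
/- Fix a percolation configuration on ℤ³, a finite subset A ⊆ ℤ³, a site x ∈ A and an integer k ≥ 1. With C_j(x) defined by C_0(x) = C(x) and C_{j+1}(x) = C_j(x) ∪ ∂ᵒᵘᵗC_j(x) ∪ {y ∈ ℤ³ : y is connected by an open path to ∂ᵒᵘᵗ(∂ᵒᵘᵗC_j(x))}: if T_A(x, ∂ⁱⁿA) ≥ k, then C_{k−1}(x) ⊆ A ∖ ∂ⁱⁿA and ∂ᵒᵘᵗC_{k−1}(x) ⊆ A. -/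
open MeasureTheory ENNReal

noncomputable section

/-- A site of the lattice `ℤ³`. -/
abbrev Site := Fin 3 → ℤ

/-- A percolation configuration: `ω z = true` means that the site `z` is open,
`ω z = false` means that it is closed. -/
abbrev Config := Site → Bool

/-- Two sites are neighbours when their Euclidean distance is `1`. -/
def Adj (x y : Site) : Prop := ∑ i, |x i - y i| = 1

/-- `γ` is a path from `x` to `y` staying inside `A`. -/
def IsPathIn (A : Set Site) (x y : Site) (γ : List Site) : Prop :=
  γ.Chain' Adj ∧ γ.head? = some x ∧ γ.getLast? = some y ∧ ∀ z ∈ γ, z ∈ A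

/-- The number of closed sites along the path `γ`. -/
def pathCost (ω : Config) (γ : List Site) : ℕ := γ.countP fun z => !ω z

/-- The travel time `T_A(x,y)` between `x` and `y` inside `A`: the infimum of the number
of closed sites over all paths from `x` to `y` in `A` (`⊤` if there is no such path). -/
def travelTime (ω : Config) (A : Set Site) (x y : Site) : ℝ≥0∞ :=
  sInf {c : ℝ≥0∞ | ∃ γ : List Site, IsPathIn A x y γ ∧ c = pathCost ω γ}

/-- The travel time `T_A(x,E)` between `x` and the set `E` inside `A`. -/
def travelTimeSet (ω : Config) (A : Set Site) (x : Site) (E : Set Site) : ℝ≥0∞ :=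
  ⨅ y ∈ E, travelTime ω A x y

/-- The open cluster `C(x)` of the site `x` (empty when `x` is closed). -/
def cluster (ω : Config) (x : Site) : Set Site :=
  {y | ∃ γ : List Site, IsPathIn {z | ω z = true} x y γ}

/-- The internal boundary `∂ⁱⁿA` of `A`. -/
def intBd (A : Set Site) : Set Site := {x | x ∈ A ∧ ∃ y ∉ A, Adj x y}

/-- The external boundary `∂ᵒᵘᵗA` of `A`. -/
def extBd (A : Set Site) : Set Site := {x | x ∉ A ∧ ∃ y ∈ A, Adj x y}

/-- `P` is the Bernoulli site percolation measure with parameter `p`: the sites are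
independent and each one is open with probability `p`, closed with probability `1 - p`,
as expressed by the probabilities of the cylinder events. -/
def IsBernoulli (p : ℝ) (P : Measure Config) : Prop :=
  ∀ (s : Finset Site) (f : Site → Bool),
    P {ω | ∀ z ∈ s, ω z = f z} =
      ∏ z ∈ s, (if f z then ENNReal.ofReal p else ENNReal.ofReal (1 - p))

/-- `θ(p)`: the probability that the open cluster of the origin is infinite. -/
def theta (P : Measure Config) : ℝ≥0∞ := P {ω | (cluster ω 0).Infinite}

/-- The box `Λ(r) = [-r, r]³ ∩ ℤ³`. -/
def box (r : ℝ) : Set Site := {z | ∀ i, |(z i : ℝ)| ≤ r}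

/-- The iterated clusters: `C_0(x) = C(x)` and
`C_{k+1}(x) = C_k(x) ∪ ∂ᵒᵘᵗC_k(x) ∪ {y : y ⟷ ∂ᵒᵘᵗ(∂ᵒᵘᵗC_k(x)) by an open path}`. -/
def clusterSeq (ω : Config) (x : Site) : ℕ → Set Site
  | 0 => cluster ω x
  | k + 1 => clusterSeq ω x k ∪ extBd (clusterSeq ω x k) ∪
      {y | ∃ w ∈ extBd (extBd (clusterSeq ω x k)), w ∈ cluster ω y}

theorem Adj.symm' {x y : Site} (h : Adj x y) : Adj y x := by
  unfold Adj at *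
  rw [← h]
  exact Finset.sum_congr rfl fun i _ => abs_sub_comm _ _

/-- `y` is reachable from `x` inside `A` with cost at most `n`. -/
def ReachIn (ω : Config) (A : Set Site) (x : Site) (n : ℕ) (y : Site) : Prop :=
  ∃ γ : List Site, IsPathIn A x y γ ∧ pathCost ω γ ≤ n

theorem ReachIn.mem {ω : Config} {A : Set Site} {x y : Site} {n : ℕ}
    (h : ReachIn ω A x n y) : y ∈ A := by
  obtain ⟨γ, ⟨_, _, h3, h4⟩, _⟩ := h
  exact h4 y (List.mem_of_getLast? h3)

theorem ReachIn.mono {ω : Config} {A : Set Site} {x y : Site} {n m : ℕ}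
    (h : ReachIn ω A x n y) (hnm : n ≤ m) : ReachIn ω A x m y := by
  obtain ⟨γ, h1, h2⟩ := h
  exact ⟨γ, h1, h2.trans hnm⟩

theorem ReachIn.notMem {ω : Config} {A : Set Site} {x y : Site} {n k : ℕ}
    (hk : (k : ℝ≥0∞) ≤ travelTimeSet ω A x (intBd A)) (hn : n < k)
    (h : ReachIn ω A x n y) : y ∉ intBd A := by
  intro hy
  obtain ⟨γ, h1, h2⟩ := h
  have h3 : travelTimeSet ω A x (intBd A) ≤ (pathCost ω γ : ℝ≥0∞) :=
    (iInf₂_le y hy).trans (sInf_le ⟨γ, h1, rfl⟩)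
  have h4 : k ≤ pathCost ω γ := by exact_mod_cast hk.trans h3
  omega

theorem ReachIn.nbr_mem {ω : Config} {A : Set Site} {x y z : Site} {n k : ℕ}
    (hk : (k : ℝ≥0∞) ≤ travelTimeSet ω A x (intBd A)) (hn : n < k)
    (h : ReachIn ω A x n y) (hyz : Adj y z) : z ∈ A := by
  by_contra hz
  exact h.notMem hk hn ⟨h.mem, z, hz, hyz⟩

theorem ReachIn.snoc {ω : Config} {A : Set Site} {x y z : Site} {n : ℕ}
    (h : ReachIn ω A x n y) (hyz : Adj y z) (hz : z ∈ A) :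
    ReachIn ω A x (n + if ω z then 0 else 1) z := by
  obtain ⟨γ, ⟨h1, h2, h3, h4⟩, h5⟩ := h
  refine ⟨γ ++ [z], ⟨?_, ?_, ?_, ?_⟩, ?_⟩
  · refine List.isChain_append.2 ⟨h1, by simp, ?_⟩
    intro a ha b hb
    rw [h3] at ha
    simp at ha hb
    subst ha hb
    exact hyz
  · simp [List.head?_append, h2]
  · simp
  · intro a ha
    rcases List.mem_append.1 ha with ha | ha
    · exact h4 a ha
    · simp at ha; exact ha ▸ hz
  · unfold pathCost at *
    rw [List.countP_append]
    cases hω : ω z <;> simp [hω] <;> omega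

theorem ReachIn.snoc_open {ω : Config} {A : Set Site} {x y z : Site} {n k : ℕ}
    (hk : (k : ℝ≥0∞) ≤ travelTimeSet ω A x (intBd A)) (hn : n < k)
    (h : ReachIn ω A x n y) (hyz : Adj y z) (hz : ω z = true) : ReachIn ω A x n z := by
  simpa [hz] using h.snoc hyz (h.nbr_mem hk hn hyz)

theorem ReachIn.snoc_any {ω : Config} {A : Set Site} {x y z : Site} {n k : ℕ}
    (hk : (k : ℝ≥0∞) ≤ travelTimeSet ω A x (intBd A)) (hn : n < k)
    (h : ReachIn ω A x n y) (hyz : Adj y z) : ReachIn ω A x (n + 1) z := by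
  refine (h.snoc hyz (h.nbr_mem hk hn hyz)).mono ?_
  split_ifs <;> omega

theorem ReachIn.forward {ω : Config} {A : Set Site} {x : Site} {n k : ℕ}
    (hk : (k : ℝ≥0∞) ≤ travelTimeSet ω A x (intBd A)) (hn : n < k) (γ : List Site) :
    ∀ a b : Site, IsPathIn {z | ω z = true} a b γ → ReachIn ω A x n a → ReachIn ω A x n b := by
  induction γ with
  | nil => intro a b h; simp [IsPathIn] at h
  | cons c γ ih =>
    rintro a b ⟨h1, h2, h3, h4⟩ ha
    simp at h2
    subst h2
    cases γ with
    | nil => simp at h3; exact h3 ▸ ha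
    | cons d γ =>
      have h1' := List.isChain_cons_cons.1 h1
      refine ih d b ⟨h1'.2, rfl, ?_, fun z hz => h4 z (List.mem_cons_of_mem _ hz)⟩
        (ha.snoc_open hk hn h1'.1 (h4 d (by simp)))
      simpa using h3

theorem ReachIn.backward {ω : Config} {A : Set Site} {x : Site} {n k : ℕ}
    (hk : (k : ℝ≥0∞) ≤ travelTimeSet ω A x (intBd A)) (hn : n < k) (γ : List Site) :
    ∀ a b : Site, IsPathIn {z | ω z = true} a b γ → ReachIn ω A x n b → ReachIn ω A x n a := by
  induction γ with
  | nil => intro a b h; simp [IsPathIn] at h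
  | cons c γ ih =>
    rintro a b ⟨h1, h2, h3, h4⟩ hb
    simp at h2
    subst h2
    cases γ with
    | nil => simp at h3; exact h3 ▸ hb
    | cons d γ =>
      have h1' := List.isChain_cons_cons.1 h1
      have hd := ih d b ⟨h1'.2, rfl, by simpa using h3,
        fun z hz => h4 z (List.mem_cons_of_mem _ hz)⟩ hb
      exact hd.snoc_open hk hn h1'.1.symm' (h4 _ (by simp))

theorem reachIn_clusterSeq {ω : Config} {A : Set Site} {x : Site} (hx : x ∈ A) {k : ℕ}
    (hk : (k : ℝ≥0∞) ≤ travelTimeSet ω A x (intBd A)) (j : ℕ) :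
    j < k → ∀ y ∈ clusterSeq ω x j, ReachIn ω A x j y := by
  induction j with
  | zero =>
    rintro hj y ⟨γ, hγ⟩
    refine ReachIn.forward hk hj γ x y hγ ⟨[x], ⟨List.isChain_singleton x, rfl, rfl, by simpa using hx⟩, ?_⟩
    have : ω x = true := hγ.2.2.2 x (List.mem_of_head? hγ.2.1)
    simp [pathCost, this]
  | succ j ih =>
    intro hj y hy
    have ih' := ih (by omega)
    have hbd : ∀ u ∈ extBd (clusterSeq ω x j), ReachIn ω A x (j + 1) u := by
      rintro u ⟨_, z, hz, huz⟩
      exact (ih' z hz).snoc_any hk (by omega) huz.symm'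
    rcases hy with (hy | hy) | ⟨w, ⟨_, u, hu, hwu⟩, γ, hγ⟩
    · exact (ih' y hy).mono (by omega)
    · exact hbd y hy
    · have hw : ω w = true := hγ.2.2.2 w (List.mem_of_getLast? hγ.2.2.1)
      exact ReachIn.backward hk hj γ y w hγ ((hbd u hu).snoc_open hk hj hwu.symm' hw)

/-- If `T_A(x, ∂ⁱⁿA) ≥ k`, then `C_{k-1}(x) ⊆ A ∖ ∂ⁱⁿA` and `∂ᵒᵘᵗC_{k-1}(x) ⊆ A`. -/
theorem stmt_3 (ω : Config) (A : Set Site) (hA : A.Finite) (x : Site) (hx : x ∈ A)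
    (k : ℕ) (hk : 1 ≤ k) (h : (k : ℝ≥0∞) ≤ travelTimeSet ω A x (intBd A)) :
    clusterSeq ω x (k - 1) ⊆ A \ intBd A ∧ extBd (clusterSeq ω x (k - 1)) ⊆ A := by
  have key := reachIn_clusterSeq hx h (k - 1) (by omega)
  refine ⟨fun y hy => ⟨(key y hy).mem, (key y hy).notMem h (by omega)⟩, ?_⟩
  rintro u ⟨_, z, hz, huz⟩
  exact (key z hz).nbr_mem h (by omega) huz.symm'
end
end

section
/- Let p ∈ [0,1] satisfy θ(p) > 0 and let α > 0. There exists a constant c > 0 (depending on α and p) such that for every integer n ≥ 2, P(ℰ(Λ(n), c ln n)) ≥ 1 − c/n^α. -/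
open MeasureTheory ENNReal

noncomputable section

/-- The two coordinates other than `d`. -/
def others : Fin 3 → Fin 3 × Fin 3 := ![(1, 2), (0, 2), (0, 1)]

/-- The square `F_i^j` of the box `x + Λ(m)` (before translation by `x`): the face of the
cube `Λ(m)` in direction `(d, ε)`, restricted to the quadrant given by the signs `s₁, s₂`
on the two other coordinates.  Each such square shares a vertex with a vertex of the cube
and admits the center of the face as another vertex. -/
def faceSq (m : ℕ) (d : Fin 3) (ε s₁ s₂ : Bool) : Set Site :=
  {z | z ∈ box m ∧ z d = (if ε then (m : ℤ) else -(m : ℤ)) ∧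
    (if s₁ then 0 ≤ z (others d).1 else z (others d).1 ≤ 0) ∧
    (if s₂ then 0 ≤ z (others d).2 else z (others d).2 ≤ 0)}

/-- The event `ℰ(Λ(n), k)`: for every cubic box `Γ = x + Λ(m)` included in `Λ(n)`, with
center `x ∈ ℤ³` and integer sidelength, the center `x` can be joined inside `Λ(n)` to each
of the `24` squares on the faces of `Γ` with a path having at most `k` closed sites. -/
def eventE (n : ℕ) (k : ℝ) : Set Config :=
  {ω | ∀ (x : Site) (m : ℕ), (x + ·) '' box m ⊆ box n →
    ∀ (d : Fin 3) (ε s₁ s₂ : Bool),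
      travelTimeSet ω (box n) x ((x + ·) '' faceSq m d ε s₁ s₂) ≤ ENNReal.ofReal k}

/-! ### Combinatorics -/

/-- Open connection inside `S` (the starting point is free). -/
def Conn (ω : Config) (S : Finset Site) (x y : Site) : Prop :=
  Relation.ReflTransGen (fun a b => Adj a b ∧ b ∈ S ∧ ω b = true) x y

/-- Sites reached from `x` in `S` with at most `k` closed sites (not counting `x`). -/
inductive Reach (ω : Config) (S : Finset Site) (x : Site) : ℕ → Site → Prop
  | base : Reach ω S x 0 x
  | opn {k : ℕ} {y z : Site} : Reach ω S x k y → Adj y z → z ∈ S → ω z = true → Reach ω S x k z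
  | step {k : ℕ} {y z : Site} : Reach ω S x k y → Adj y z → z ∈ S → Reach ω S x (k + 1) z
  | up {k : ℕ} {y : Site} : Reach ω S x k y → Reach ω S x (k + 1) y

lemma Reach.mono {ω : Config} {S : Finset Site} {x y : Site} {j k : ℕ} (h : Reach ω S x j y)
    (hjk : j ≤ k) : Reach ω S x k y := by
  induction hjk with
  | refl => exact h
  | step _ ih => exact ih.up

lemma Reach.mem {ω : Config} {S : Finset Site} {x y : Site} {k : ℕ} (h : Reach ω S x k y)
    (hx : x ∈ S) : y ∈ S := by
  induction h with
  | base => exact hx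
  | opn _ _ h _ _ => exact h
  | step _ _ h _ => exact h
  | up _ ih => exact ih

lemma Reach.base' {ω : Config} {S : Finset Site} {x : Site} (k : ℕ) : Reach ω S x k x :=
  Reach.base.mono (Nat.zero_le k)

open Classical in
/-- The explored set. -/
def expl (ω : Config) (S : Finset Site) (x : Site) (k : ℕ) : Finset Site :=
  S.filter fun y => Reach ω S x k y

open Classical in
/-- A set together with its outer boundary in `S`. -/
def clo (S A : Finset Site) : Finset Site := S.filter fun z => z ∈ A ∨ ∃ y ∈ A, Adj y z

open Classical in
lemma mem_expl {ω : Config} {S : Finset Site} {x y : Site} {k : ℕ} :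
    y ∈ expl ω S x k ↔ y ∈ S ∧ Reach ω S x k y := by
  unfold expl; exact Finset.mem_filter

open Classical in
lemma mem_clo {S A : Finset Site} {z : Site} :
    z ∈ clo S A ↔ z ∈ S ∧ (z ∈ A ∨ ∃ y ∈ A, Adj y z) := by
  unfold clo; exact Finset.mem_filter

lemma expl_local_aux {ω ω' : Config} {S : Finset Site} {x : Site} {k : ℕ} (hx : x ∈ S)
    (h : ∀ z ∈ clo S (expl ω S x k), ω z = ω' z) {j : ℕ} {y : Site} :
    (Reach ω S x j y → j ≤ k → Reach ω' S x j y) ∧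
    (Reach ω' S x j y → j ≤ k → Reach ω S x j y) := by
  constructor
  · intro hr
    induction hr with
    | base => intro _; exact Reach.base
    | @opn j y z hr hadj hz ho ih =>
      intro hj
      refine (ih hj).opn hadj hz ?_
      rw [← h z, ho]
      have := (hr.opn hadj hz ho).mono hj
      exact mem_clo.2 ⟨hz, Or.inl (mem_expl.2 ⟨hz, this⟩)⟩
    | step hr hadj hz ih => intro hj; exact (ih (by omega)).step hadj hz
    | up hr ih => intro hj; exact (ih (by omega)).up
  · intro hr
    induction hr with
    | base => intro _; exact Reach.base
    | @opn j y z hr hadj hz ho ih =>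
      intro hj
      refine (ih hj).opn hadj hz ?_
      rw [h z, ho]
      have h1 := (ih hj).mono hj
      have h2 := h1.mem hx
      exact mem_clo.2 ⟨hz, Or.inr ⟨y, mem_expl.2 ⟨h2, h1⟩, hadj⟩⟩
    | step hr hadj hz ih => intro hj; exact (ih (by omega)).step hadj hz
    | up hr ih => intro hj; exact (ih (by omega)).up

lemma expl_local {ω ω' : Config} {S A : Finset Site} {x : Site} {k : ℕ} (hx : x ∈ S)
    (h : ∀ z ∈ clo S A, ω z = ω' z) (hA : expl ω S x k = A) : expl ω' S x k = A := by
  subst hA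
  ext y
  have := expl_local_aux hx h (j := k) (y := y)
  simp only [mem_expl]
  have h1 := this.1
  have h2 := this.2
  have h3 := le_refl k
  tauto

open Classical in
/-- Open all the sites of `B`. -/
def openOn (B : Finset Site) (ω : Config) : Config := fun z => if z ∈ B then true else ω z

lemma conn_mono {ω ω' : Config} {S : Finset Site} {x y : Site}
    (h : ∀ z ∈ S, ω z = true → ω' z = true) (hc : Conn ω S x y) : Conn ω' S x y :=
  Relation.ReflTransGen.mono (fun _ b hab => ⟨hab.1, hab.2.1, h b hab.2.1 hab.2.2⟩) _ _ hc

lemma reach_of_conn {ω : Config} {S : Finset Site} {x y : Site} {k : ℕ} 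
    (hc : Conn (openOn (clo S (expl ω S x k)) ω) S x y) : Reach ω S x (k + 1) y := by
  induction hc with
  | refl => exact Reach.base' _
  | @tail y z _ hyz ih =>
    obtain ⟨hadj, hz, ho⟩ := hyz
    by_cases h : ω z = true
    · exact ih.opn hadj hz h
    · simp only [openOn] at ho
      have : Reach ω S x k z ∨ ∃ y, Reach ω S x k y ∧ Adj y z := by
        by_contra hcon
        push Not at hcon
        rw [if_neg] at ho
        · exact h ho
        · intro hmem
          rcases (mem_clo.1 hmem).2 with h | ⟨y, h1, h2⟩
          · exact hcon.1 (mem_expl.1 h).2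
          · exact hcon.2 y (mem_expl.1 h1).2 h2
      rcases this with h | ⟨y, h1, h2⟩
      · exact h.up
      · exact h1.step h2 hz

lemma exists_path_of_reach {ω : Config} {S : Finset Site} {x y : Site} {k : ℕ} (hx : x ∈ S)
    (h : Reach ω S x k y) :
    ∃ γ, IsPathIn (S : Set Site) x y γ ∧ pathCost ω γ ≤ k + 1 := by
  have ext : ∀ {y z γ}, IsPathIn (S : Set Site) x y γ → Adj y z → z ∈ S →
      IsPathIn (S : Set Site) x z (γ ++ [z]) := by
    rintro y z γ ⟨h1, h2, h3, h4⟩ hadj hz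
    refine ⟨?_, ?_, by simp, ?_⟩
    · refine List.IsChain.append h1 (by simp) ?_
      intro a ha b hb
      simp_all
    · cases γ with
      | nil => simp at h2
      | cons a l => simpa using h2
    · intro w hw
      simp only [List.mem_append, List.mem_singleton] at hw
      rcases hw with hw | rfl
      · exact h4 w hw
      · exact hz
  induction h with
  | base =>
    refine ⟨[x], ⟨List.isChain_singleton x, by simp, by simp, by simpa using hx⟩, ?_⟩
    exact List.countP_le_length
  | @opn k y z _ hadj hz ho ih =>
    obtain ⟨γ, h1, h2⟩ := ih
    refine ⟨_, ext h1 hadj hz, ?_⟩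
    simpa [pathCost, ho] using h2
  | @step k y z _ hadj hz ih =>
    obtain ⟨γ, h1, h2⟩ := ih
    refine ⟨_, ext h1 hadj hz, ?_⟩
    simp only [pathCost, List.countP_append] at h2 ⊢
    have : List.countP (fun z => !ω z) [z] ≤ 1 := List.countP_le_length
    omega
  | up _ ih =>
    obtain ⟨γ, h1, h2⟩ := ih
    exact ⟨γ, h1, by omega⟩

/-! ### Probability -/

lemma measurableSet_of_dep {E : Set Config} (s : Finset Site)
    (h : ∀ ω ω' : Config, (∀ z ∈ s, ω z = ω' z) → ω ∈ E → ω' ∈ E) :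
    ∃ U : Set (s → Bool), E = (fun (ω : Config) (i : s) => ω i) ⁻¹' U := by
  refine ⟨(fun (ω : Config) (i : s) => ω i) '' E, ?_⟩
  ext ω
  constructor
  · intro hω; exact ⟨ω, hω, rfl⟩
  · rintro ⟨ω', hω', heq⟩
    exact h ω' ω (fun z hz => congrFun heq ⟨z, hz⟩) hω'

lemma measurableSet_of_dep' {E : Set Config} (s : Finset Site)
    (h : ∀ ω ω' : Config, (∀ z ∈ s, ω z = ω' z) → ω ∈ E → ω' ∈ E) : MeasurableSet E := by
  obtain ⟨U, rfl⟩ := measurableSet_of_dep s h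
  exact (measurable_pi_lambda _ fun i => measurable_pi_apply _) U.toFinite.measurableSet

lemma bern_marginal {p : ℝ} {P : Measure Config} (hP : IsBernoulli p P) (z : Site) :
    P {ω | ω z = true} = ENNReal.ofReal p := by
  simpa using hP {z} (fun _ => true)

lemma bern_iIndep {p : ℝ} {P : Measure Config} [IsProbabilityMeasure P] (hP : IsBernoulli p P) :
    ProbabilityTheory.iIndepFun (fun (z : Site) (ω : Config) => ω z) P := by
  have h1 : ProbabilityTheory.iIndepSet (fun z : Site => {ω : Config | ω z = true}) P := by
    rw [ProbabilityTheory.iIndepSet_iff_meas_biInter]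
    · intro s
      have := hP s (fun _ => true)
      simp only [bern_marginal hP, if_true] at this ⊢
      rw [← this]
      congr 1
      ext ω
      simp
    · intro z
      exact measurableSet_of_dep' {z} fun ω ω' h hω => by
        rw [Set.mem_ofPred_eq, ← h z (by simp)]; exact hω
  have hg : (⊤ : MeasurableSpace Bool) = MeasurableSpace.generateFrom {{true}} := by
    refine le_antisymm ?_ le_top
    intro s _
    have ht : @MeasurableSet _ (MeasurableSpace.generateFrom {({true} : Set Bool)}) {true} :=
      MeasurableSpace.measurableSet_generateFrom rfl
    have hf : @MeasurableSet _ (MeasurableSpace.generateFrom {({true} : Set Bool)}) {false} := by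
      have := ht.compl
      convert this using 1
      ext b; cases b <;> simp
    rw [← Set.biUnion_of_singleton s]
    refine MeasurableSet.biUnion s.to_countable fun b _ => ?_
    cases b
    · exact hf
    · exact ht
  rw [ProbabilityTheory.iIndepFun_iff_iIndep]
  convert (ProbabilityTheory.iIndepSet_iff_iIndep _ _).1 h1 using 2 with z
  change MeasurableSpace.comap _ ⊤ = _
  rw [hg, MeasurableSpace.comap_generateFrom]
  simp

lemma bern_unique {p : ℝ} {P Q : Measure Config} [IsProbabilityMeasure P] [IsProbabilityMeasure Q]
    (hP : IsBernoulli p P) (hQ : IsBernoulli p Q) : P = Q := by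
  have hp := (bern_iIndep hP).map_fun_eq_infinitePi_map (fun z => measurable_pi_apply z)
  have hq := (bern_iIndep hQ).map_fun_eq_infinitePi_map (fun z => measurable_pi_apply z)
  have e : ∀ z : Site, P.map (fun ω : Config => ω z) = Q.map (fun ω : Config => ω z) := by
    intro z
    refine Measure.ext_of_singleton fun b => ?_
    rw [Measure.map_apply (measurable_pi_apply z) (measurableSet_singleton _),
      Measure.map_apply (measurable_pi_apply z) (measurableSet_singleton _)]
    have h1 := hP {z} (fun _ => b)
    have h2 := hQ {z} (fun _ => b)
    rw [← h2] at h1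
    convert h1 using 2 <;> (ext ω; simp)
  simp only [e] at hp
  rw [← hq] at hp
  simpa using hp

lemma bern_map {p : ℝ} {P : Measure Config} [IsProbabilityMeasure P] (hP : IsBernoulli p P)
    (σ : Site ≃ Site) : P.map (fun ω z => ω (σ z)) = P := by
  have hm : Measurable (fun (ω : Config) (z : Site) => ω (σ z)) :=
    measurable_pi_lambda _ fun i => measurable_pi_apply _
  have := Measure.isProbabilityMeasure_map (μ := P) hm.aemeasurable
  refine bern_unique (p := p) ?_ hP
  intro s f
  rw [Measure.map_apply hm]
  · have := hP (s.map σ.toEmbedding) (fun z => f (σ.symm z))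
    simp only [Finset.prod_map, Finset.mem_map] at this
    simp only [Equiv.coe_toEmbedding, Equiv.symm_apply_apply] at this
    rw [← this]
    congr 1
    ext ω
    simp
  · exact measurableSet_of_dep' s (fun ω ω' h hω z hz => by rw [← h z hz]; exact hω z hz)

lemma conn_dep {S : Finset Site} {x : Site} {F : Set Site} (ω ω' : Config)
    (h : ∀ z ∈ S, ω z = ω' z) (hc : ∃ y ∈ F, Conn ω S x y) : ∃ y ∈ F, Conn ω' S x y := by
  obtain ⟨y, hy, hc⟩ := hc
  exact ⟨y, hy, conn_mono (fun z hz ho => by rw [← h z hz, ho]) hc⟩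

lemma conn_sym {p : ℝ} {P : Measure Config} [IsProbabilityMeasure P] (hP : IsBernoulli p P)
    (σ : Site ≃ Site) (hσ : ∀ a b, Adj a b → Adj (σ a) (σ b)) {S S' : Finset Site}
    {F F' : Set Site} {x : Site} (hS : ∀ z ∈ S, σ z ∈ S') (hF : ∀ z ∈ F, σ z ∈ F') :
    P {ω | ∃ y ∈ F, Conn ω S x y} ≤ P {ω | ∃ y ∈ F', Conn ω S' (σ x) y} := by
  have hm : Measurable (fun (ω : Config) (z : Site) => ω (σ z)) :=
    measurable_pi_lambda _ fun i => measurable_pi_apply _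
  nth_rewrite 1 [← bern_map hP σ]
  rw [Measure.map_apply hm 
    (measurableSet_of_dep' (E := {ω | ∃ y ∈ F, Conn ω S x y}) S
      fun ω ω' h hω => conn_dep ω ω' h hω)]
  refine measure_mono ?_
  rintro ω ⟨y, hy, hc⟩
  refine ⟨σ y, hF y hy, ?_⟩
  exact Relation.ReflTransGen.lift σ (fun a b h => ⟨hσ a b h.1, hS b h.2.1, h.2.2⟩) _ _ hc

open Classical in
lemma decay_step {p : ℝ} {P : Measure Config} [IsProbabilityMeasure P] (hP : IsBernoulli p P)
    {S : Finset Site} {F : Set Site} {x : Site} (hx : x ∈ S) {δ : ℝ≥0∞}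
    (hδ : δ ≤ P {ω | ∃ y ∈ F, Conn ω S x y}) (k : ℕ) :
    P {ω | ¬ ∃ y ∈ F, Reach ω S x (k + 1) y} ≤
      (1 - δ) * P {ω | ¬ ∃ y ∈ F, Reach ω S x k y} := by
  set 𝒜 : Finset (Finset Site) := S.powerset.filter fun A => ∀ y ∈ A, y ∉ F with h𝒜
  let G : Finset Site → Set Config := fun A => {ω | ∃ y ∈ F, Conn (openOn (clo S A) ω) S x y}
  let X : Finset Site → Set Config := fun A => {ω | expl ω S x k = A}
  have hX : ∀ A, MeasurableSet (X A) := fun A =>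
    measurableSet_of_dep' (clo S A) fun ω ω' h hω => expl_local hx h hω
  have hGdep : ∀ A, ∀ ω ω' : Config, (∀ z ∈ S \ clo S A, ω z = ω' z) → ω ∈ G A → ω' ∈ G A := by
    intro A ω ω' h hω
    refine conn_dep _ _ ?_ hω
    intro z hz
    unfold openOn
    split_ifs with hzA
    · rfl
    · exact h z (Finset.mem_sdiff.2 ⟨hz, hzA⟩)
  have hG : ∀ A, MeasurableSet (G A) := fun A => measurableSet_of_dep' _ (hGdep A)
  have hGδ : ∀ A, P (G A)ᶜ ≤ 1 - δ := by
    intro A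
    rw [prob_compl_eq_one_sub (hG A)]
    refine tsub_le_tsub_left (hδ.trans (measure_mono ?_)) _
    rintro ω ⟨y, hy, hc⟩
    refine ⟨y, hy, conn_mono ?_ hc⟩
    intro z _ ho
    simp [openOn, ho]
  have hind : ∀ A, P (X A ∩ (G A)ᶜ) = P (X A) * P (G A)ᶜ := by
    intro A
    have hI := (bern_iIndep hP).indepFun_finset (clo S A) (S \ clo S A) Finset.disjoint_sdiff
      (fun z => measurable_pi_apply z)
    obtain ⟨U, hU⟩ := measurableSet_of_dep (E := X A) (clo S A)
      fun ω ω' h hω => expl_local hx h hω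
    obtain ⟨V, hV⟩ := measurableSet_of_dep (E := (G A)ᶜ) (S \ clo S A)
      fun ω ω' h hω hω' => hω (hGdep A ω' ω (fun z hz => (h z hz).symm) hω')
    rw [hU, hV]
    exact hI.measure_inter_preimage_eq_mul _ _ U.toFinite.measurableSet V.toFinite.measurableSet
  calc P {ω | ¬ ∃ y ∈ F, Reach ω S x (k + 1) y}
      ≤ P (⋃ A ∈ 𝒜, X A ∩ (G A)ᶜ) := by
        refine measure_mono ?_
        intro ω hω
        simp only [Set.mem_iUnion]
        refine ⟨expl ω S x k, ?_, rfl, ?_⟩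
        · rw [h𝒜, Finset.mem_filter, Finset.mem_powerset]
          refine ⟨fun y hy => (mem_expl.1 hy).1, fun y hy hyF => hω ⟨y, hyF, (mem_expl.1 hy).2.up⟩⟩
        · rintro ⟨y, hy, hc⟩
          exact hω ⟨y, hy, reach_of_conn hc⟩
    _ ≤ ∑ A ∈ 𝒜, P (X A ∩ (G A)ᶜ) := measure_biUnion_finset_le _ _
    _ ≤ ∑ A ∈ 𝒜, (1 - δ) * P (X A) := by
        refine Finset.sum_le_sum fun A _ => ?_
        rw [hind, mul_comm]
        gcongr
        exact hGδ A
    _ = (1 - δ) * P (⋃ A ∈ 𝒜, X A) := by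
        rw [← Finset.mul_sum, measure_biUnion_finset _ (fun A _ => hX A)]
        intro A _ B _ hAB
        refine Set.disjoint_left.2 fun ω hA hB => hAB (hA.symm.trans hB)
    _ ≤ _ := by
        gcongr
        intro ω hω
        simp only [Set.mem_iUnion] at hω
        obtain ⟨A, hA, rfl⟩ := hω
        rintro ⟨y, hy, hr⟩
        exact (Finset.mem_filter.1 hA).2 y (mem_expl.2 ⟨hr.mem hx, hr⟩) hy

lemma decay {p : ℝ} {P : Measure Config} [IsProbabilityMeasure P] (hP : IsBernoulli p P)
    {S : Finset Site} {F : Set Site} {x : Site} (hx : x ∈ S) {δ : ℝ≥0∞}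
    (hδ : δ ≤ P {ω | ∃ y ∈ F, Conn ω S x y}) (k : ℕ) :
    P {ω | ¬ ∃ y ∈ F, Reach ω S x k y} ≤ (1 - δ) ^ k := by
  induction k with
  | zero => simpa using prob_le_one
  | succ k ih =>
    refine (decay_step hP hx hδ k).trans ?_
    rw [pow_succ, mul_comm]
    gcongr

/-! ### Geometry -/

/-- The box `x + Λ(m)` as a finset. -/
def bx (x : Site) (m : ℕ) : Finset Site :=
  Finset.Icc (fun i => x i - (m : ℤ)) (fun i => x i + (m : ℤ))

lemma mem_bx {x z : Site} {m : ℕ} : z ∈ bx x m ↔ ∀ i, |z i - x i| ≤ m := by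
  simp only [bx, Finset.mem_Icc, Pi.le_def, abs_le]
  constructor
  · intro h i; have := h.1 i; have := h.2 i; omega
  · intro h; constructor <;> intro i <;> have := h i <;> omega

lemma mem_box {z : Site} {m : ℕ} : z ∈ box (m : ℝ) ↔ ∀ i, |z i| ≤ m := by
  unfold box
  refine forall_congr' fun i => ?_
  exact_mod_cast Iff.rfl

lemma adj_coord {x y : Site} (h : Adj x y) (i : Fin 3) : |x i - y i| ≤ 1 := by
  unfold Adj at h
  rw [← h]
  exact Finset.single_le_sum (f := fun i => |x i - y i|) (fun j _ => abs_nonneg _)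
    (Finset.mem_univ i)

lemma rtg_of_path {ω : Config} (γ : List Site) : ∀ {x y : Site},
    IsPathIn {z | ω z = true} x y γ →
    Relation.ReflTransGen (fun a b => Adj a b ∧ ω b = true) x y := by
  induction γ with
  | nil => rintro x y ⟨_, h, _⟩; simp at h
  | cons a l ih =>
    rintro x y ⟨h1, h2, h3, h4⟩
    simp only [List.head?_cons, Option.some.injEq] at h2
    subst h2
    cases l with
    | nil =>
      simp only [List.getLast?_singleton, Option.some.injEq] at h3
      subst h3; exact Relation.ReflTransGen.refl
    | cons b l =>
      have hc := List.isChain_cons_cons.1 h1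
      refine Relation.ReflTransGen.head ⟨hc.1, h4 b (by simp)⟩ (ih ⟨hc.2, rfl, ?_, ?_⟩)
      · simpa using h3
      · intro z hz; exact h4 z (List.mem_cons_of_mem _ hz)

lemma exit_face {ω : Config} {m : ℕ} (h : (cluster ω 0).Infinite) :
    ∃ (d : Fin 3) (ε s₁ s₂ : Bool), ∃ y ∈ faceSq m d ε s₁ s₂, Conn ω (bx 0 m) 0 y := by
  obtain ⟨y, hy, hyb⟩ := h.exists_notMem_finset (bx 0 m)
  obtain ⟨γ, hγ⟩ := hy
  have hr := rtg_of_path γ hγ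
  have key : (y ∈ bx 0 m ∧ Conn ω (bx 0 m) 0 y) ∨
      ∃ (d : Fin 3) (ε s₁ s₂ : Bool), ∃ y ∈ faceSq m d ε s₁ s₂, Conn ω (bx 0 m) 0 y := by
    clear hγ hyb
    induction hr with
    | refl => left; exact ⟨mem_bx.2 (by simp), Relation.ReflTransGen.refl⟩
    | @tail y z _ hyz ih =>
      rcases ih with ⟨hy, hc⟩ | h
      · by_cases hz : z ∈ bx 0 m
        · left; exact ⟨hz, hc.tail ⟨hyz.1, hz, hyz.2⟩⟩
        · right
          have hy' := mem_bx.1 hy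
          rw [mem_bx] at hz
          push Not at hz
          obtain ⟨i, hi⟩ := hz
          have h1 := adj_coord hyz.1 i
          have h2 := hy' i
          simp only [Pi.zero_apply, sub_zero] at hi h2 hy'
          refine ⟨i, decide (y i = m), decide (0 ≤ y (others i).1), decide (0 ≤ y (others i).2),
            y, ⟨mem_box.2 hy', ?_, ?_, ?_⟩, hc⟩
          · by_cases h3 : y i = m
            · simp [h3]
            · simp only [h3, decide_false, Bool.false_eq_true, if_false]
              rw [abs_le] at h1 h2
              rw [lt_abs] at hi
              omega
          · by_cases h3 : 0 ≤ y (others i).1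
            · simp [h3]
            · simp only [h3, decide_false, Bool.false_eq_true, if_false]; omega
          · by_cases h3 : 0 ≤ y (others i).2
            · simp [h3]
            · simp only [h3, decide_false, Bool.false_eq_true, if_false]; omega
      · exact Or.inr h
  exact key.resolve_left fun h => hyb h.1

/-- sign of a boolean -/
def sg (b : Bool) : ℤ := if b then 1 else -1

lemma sg_mul_self (b : Bool) : sg b * sg b = 1 := by cases b <;> simp [sg]
lemma abs_sg (b : Bool) : |sg b| = 1 := by cases b <;> simp [sg]

/-- Signed coordinate permutation. -/
def sperm (π : Equiv.Perm (Fin 3)) (s : Fin 3 → Bool) : Site ≃ Site where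
  toFun z := fun i => sg (s (π i)) * z (π i)
  invFun w := fun i => sg (s i) * w (π.symm i)
  left_inv z := by
    funext i
    simp [← mul_assoc, sg_mul_self]
  right_inv w := by
    funext i
    simp [← mul_assoc, sg_mul_self]

lemma sperm_apply (π : Equiv.Perm (Fin 3)) (s : Fin 3 → Bool) (z : Site) (i : Fin 3) :
    sperm π s z i = sg (s (π i)) * z (π i) := rfl

lemma sperm_symm_apply (π : Equiv.Perm (Fin 3)) (s : Fin 3 → Bool) (z : Site) (i : Fin 3) :
    (sperm π s).symm z i = sg (s i) * z (π.symm i) := rfl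

lemma sperm_adj (π : Equiv.Perm (Fin 3)) (s : Fin 3 → Bool) (a b : Site) :
    Adj (sperm π s a) (sperm π s b) ↔ Adj a b := by
  unfold Adj
  simp only [sperm_apply, ← mul_sub, abs_mul, abs_sg, one_mul]
  rw [Equiv.sum_comp π (fun i => |a i - b i|)]

lemma sperm_bx (π : Equiv.Perm (Fin 3)) (s : Fin 3 → Bool) (m : ℕ) (z : Site) :
    sperm π s z ∈ bx 0 m ↔ z ∈ bx 0 m := by
  simp only [mem_bx, Pi.zero_apply, sub_zero, sperm_apply, abs_mul, abs_sg, one_mul]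
  exact π.forall_congr_left.trans (by simp)

lemma bx_zero {m : ℕ} {z : Site} : z ∈ bx 0 m ↔ z ∈ box (m : ℝ) := by
  simp [mem_bx, mem_box]

/-- The signs attached to a quarter face. -/
def sgns (d : Fin 3) (ε s₁ s₂ : Bool) : Fin 3 → Bool := fun i =>
  if i = d then ε else if i = (others d).1 then s₁ else s₂

lemma sperm_face (m : ℕ) (d : Fin 3) (ε s₁ s₂ : Bool) (z : Site) :
    sperm (Equiv.swap 0 d) (sgns d ε s₁ s₂) z ∈ faceSq m 0 true true true ↔
      z ∈ faceSq m d ε s₁ s₂ := by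
  change (_ ∈ box m ∧ _ ∧ _ ∧ _) ↔ (_ ∈ box m ∧ _ ∧ _ ∧ _)
  rw [← bx_zero, ← bx_zero, sperm_bx]
  refine and_congr_right fun _ => ?_
  have e1 : Equiv.swap (0 : Fin 3) 1 2 = 2 := by decide
  have e2 : Equiv.swap (0 : Fin 3) 2 1 = 1 := by decide
  fin_cases d <;> cases ε <;> cases s₁ <;> cases s₂ <;>
    simp [sperm_apply, others, sgns, sg, e1, e2] <;> omega

lemma face_le {p : ℝ} {P : Measure Config} [IsProbabilityMeasure P] (hP : IsBernoulli p P)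
    (m : ℕ) (d : Fin 3) (ε s₁ s₂ : Bool) :
    P {ω | ∃ y ∈ faceSq m d ε s₁ s₂, Conn ω (bx 0 m) 0 y} =
    P {ω | ∃ y ∈ faceSq m 0 true true true, Conn ω (bx 0 m) 0 y} := by
  set σ := sperm (Equiv.swap 0 d) (sgns d ε s₁ s₂) with hσ
  have h0 : σ 0 = 0 := by funext i; simp [hσ, sperm_apply]
  have h0' : σ.symm 0 = 0 := by rw [Equiv.symm_apply_eq, h0]
  apply le_antisymm
  · have := conn_sym hP σ (fun a b h => (sperm_adj _ _ a b).2 h) (S := bx 0 m) (S' := bx 0 m)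
      (F := faceSq m d ε s₁ s₂) (F' := faceSq m 0 true true true) (x := 0)
      (fun z hz => (sperm_bx _ _ _ _).2 hz) (fun z hz => (sperm_face _ _ _ _ _ _).2 hz)
    rwa [h0] at this
  · have := conn_sym hP σ.symm (fun a b h => (sperm_adj (Equiv.swap 0 d) (sgns d ε s₁ s₂) _ _).1
        (by rw [← hσ]; simpa using h)) (S := bx 0 m) (S' := bx 0 m)
      (F' := faceSq m d ε s₁ s₂) (F := faceSq m 0 true true true) (x := 0)
      (fun z hz => (sperm_bx (Equiv.swap 0 d) (sgns d ε s₁ s₂) _ _).1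
        (by rw [← hσ]; simpa using hz))
      (fun z hz => (sperm_face _ _ _ _ _ _).1 (by rw [← hσ]; simpa using hz))
    rwa [h0'] at this

lemma theta_le {p : ℝ} {P : Measure Config} [IsProbabilityMeasure P] (hP : IsBernoulli p P)
    (m : ℕ) (d : Fin 3) (ε s₁ s₂ : Bool) (x : Site) :
    theta P / 24 ≤ P {ω | ∃ y ∈ (x + ·) '' faceSq m d ε s₁ s₂, Conn ω (bx x m) x y} := by
  have h1 : theta P ≤ ∑ i : Fin 3 × Bool × Bool × Bool,
      P {ω | ∃ y ∈ faceSq m i.1 i.2.1 i.2.2.1 i.2.2.2, Conn ω (bx 0 m) 0 y} := by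
    refine le_trans (measure_mono ?_) (measure_iUnion_fintype_le P _)
    intro ω hω
    obtain ⟨d, ε, s₁, s₂, h⟩ := exit_face (m := m) hω
    exact Set.mem_iUnion.2 ⟨(d, ε, s₁, s₂), h⟩
  simp only [face_le hP] at h1
  rw [← face_le hP m d ε s₁ s₂] at h1
  simp only [Finset.sum_const, Finset.card_univ, Fintype.card_prod, Fintype.card_fin,
    Fintype.card_bool, nsmul_eq_mul] at h1
  norm_num at h1
  have h2 : theta P / 24 ≤ P {ω | ∃ y ∈ faceSq m d ε s₁ s₂, Conn ω (bx 0 m) 0 y} := by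
    refine ENNReal.div_le_of_le_mul ?_
    rwa [mul_comm]
  refine h2.trans ?_
  have := conn_sym hP (Equiv.addLeft x) (fun a b h => by unfold Adj at h ⊢; simpa using h)
    (S := bx 0 m) (S' := bx x m) (F := faceSq m d ε s₁ s₂)
    (F' := (x + ·) '' faceSq m d ε s₁ s₂) (x := 0)
    (fun z hz => by rw [mem_bx] at hz ⊢; simpa using hz)
    (fun z hz => ⟨z, hz, rfl⟩)
  simpa using this

lemma bad_subset (n k : ℕ) (t : ℝ) (hk : (k : ℝ) + 1 ≤ t) :
    (eventE n t)ᶜ ⊆ ⋃ i ∈ (bx 0 n ×ˢ Finset.range (n + 1) ×ˢ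
      (Finset.univ : Finset (Fin 3 × Bool × Bool × Bool))),
      {ω | ¬ ∃ y ∈ (i.1 + ·) '' faceSq i.2.1 i.2.2.1 i.2.2.2.1 i.2.2.2.2.1 i.2.2.2.2.2,
        Reach ω (bx i.1 i.2.1) i.1 k y} := by
  intro ω hω
  by_contra hcon
  apply hω
  intro x m hsub d ε s₁ s₂
  have hmem : ∀ z ∈ bx x m, z ∈ box (n : ℝ) := by
    intro z hz
    apply hsub
    refine ⟨z - x, ?_, by simp⟩
    change z - x ∈ box (m : ℝ)
    rw [mem_box]
    rw [mem_bx] at hz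
    simpa using hz
  have hx : x ∈ bx x m := mem_bx.2 (by simp)
  have hxn : x ∈ bx 0 n := bx_zero.2 (hmem x hx)
  have hmn : m ≤ n := by
    have ha := mem_box.1 (hmem (fun i => x i + m) (mem_bx.2 (by simp))) 0
    have hb := mem_box.1 (hmem (fun i => x i - m) (mem_bx.2 (by simp))) 0
    rw [abs_le] at ha hb
    omega
  have : ∃ y ∈ (x + ·) '' faceSq m d ε s₁ s₂, Reach ω (bx x m) x k y := by
    by_contra hno
    apply hcon
    simp only [Set.mem_iUnion]
    refine ⟨(x, m, d, ε, s₁, s₂), ?_, hno⟩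
    simp [hxn]
    omega
  obtain ⟨y, hy, hr⟩ := this
  obtain ⟨γ, hγ, hcost⟩ := exists_path_of_reach hx hr
  refine (iInf₂_le y hy).trans ?_
  have hγ' : IsPathIn (box n) x y γ :=
    ⟨hγ.1, hγ.2.1, hγ.2.2.1, fun z hz => hmem z (hγ.2.2.2 z hz)⟩
  have hle : travelTime ω (box n) x y ≤ (pathCost ω γ : ℝ≥0∞) := sInf_le ⟨γ, hγ', rfl⟩
  refine hle.trans ?_
  rw [← ENNReal.ofReal_natCast]
  refine ENNReal.ofReal_le_ofReal (le_trans ?_ hk)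
  exact_mod_cast hcost

lemma card_bx (n : ℕ) : (bx 0 n).card = (2 * n + 1) ^ 3 := by
  unfold bx
  rw [Pi.card_Icc]
  simp only [Pi.zero_apply, Int.card_Icc, Finset.prod_const, Finset.card_univ, Fintype.card_fin]
  congr 1
  omega

lemma bad_prob {p : ℝ} {P : Measure Config} [IsProbabilityMeasure P] (hP : IsBernoulli p P)
    (n k : ℕ) (t : ℝ) (hk : (k : ℝ) + 1 ≤ t) :
    P (eventE n t)ᶜ ≤ (((2 * n + 1) ^ 3 * ((n + 1) * 24) : ℕ) : ℝ≥0∞) * (1 - theta P / 24) ^ k := by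
  refine (measure_mono (bad_subset n k t hk)).trans ?_
  refine (measure_biUnion_finset_le _ _).trans ?_
  refine (Finset.sum_le_card_nsmul _ _ ((1 - theta P / 24) ^ k) ?_).trans ?_
  · rintro ⟨x, m, d, ε, s₁, s₂⟩ _
    exact decay hP (mem_bx.2 (by simp)) (theta_le hP m d ε s₁ s₂ x) k
  · rw [nsmul_eq_mul, Finset.card_product, Finset.card_product, card_bx]
    simp

lemma real_bound (r α c : ℝ) (hr0 : 1 / 2 ≤ r) (hr1 : r < 1)
    (hc1 : 5184 ≤ c) (hc2 : (4 + α) / (-Real.log r) ≤ c) (n k : ℕ) (hn : 2 ≤ n)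
    (hk : c * Real.log n ≤ k + 2) :
    (((2 * n + 1) ^ 3 * ((n + 1) * 24) : ℕ) : ℝ) * r ^ k ≤ c / (n : ℝ) ^ α := by
  have hrpos : 0 < r := by linarith
  have hL : 0 < -Real.log r := by have := Real.log_neg hrpos hr1; linarith
  set L := -Real.log r with hLdef
  have hn' : (2 : ℝ) ≤ n := by exact_mod_cast hn
  have hnpos : (0 : ℝ) < n := by linarith
  have hlog : 0 < Real.log n := Real.log_pos (by linarith)
  have hcL : 4 + α ≤ c * L := (div_le_iff₀ hL).1 hc2
  have h1 : (((2 * n + 1) ^ 3 * ((n + 1) * 24) : ℕ) : ℝ) ≤ 1296 * (n : ℝ) ^ 4 := by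
    push_cast
    have a1 : (2 * (n : ℝ) + 1) ^ 3 ≤ (3 * n) ^ 3 := by gcongr; linarith
    have a2 : ((n : ℝ) + 1) * 24 ≤ (2 * n) * 24 := by gcongr; linarith
    calc _ ≤ (3 * (n : ℝ)) ^ 3 * ((2 * n) * 24) := by gcongr
      _ = _ := by ring
  have hexp : Real.exp (-L) = r := by rw [hLdef, neg_neg, Real.exp_log hrpos]
  have h2 : r ^ k ≤ 4 * ((n : ℝ) ^ 4 * (n : ℝ) ^ α)⁻¹ := by
    have e1 : r ^ k * r ^ 2 = Real.exp (-(L * (k + 2))) := by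
      rw [← pow_add, ← hexp, ← Real.exp_nat_mul]
      congr 1; push_cast; ring
    have e2 : Real.exp (-(L * (k + 2))) ≤ Real.exp (-((4 + α) * Real.log n)) := by
      apply Real.exp_le_exp.2
      have b1 : L * (c * Real.log n) ≤ L * (k + 2) := by gcongr
      have b2 : (4 + α) * Real.log n ≤ (c * L) * Real.log n := by gcongr
      linarith
    have e3 : Real.exp (-((4 + α) * Real.log n)) = ((n : ℝ) ^ 4 * (n : ℝ) ^ α)⁻¹ := by
      rw [Real.exp_neg, ← Real.rpow_natCast, ← Real.rpow_add hnpos, Real.rpow_def_of_pos hnpos]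
      congr 2; push_cast; ring
    rw [← e3]
    have e4 : (1 / 4 : ℝ) ≤ r ^ 2 := by nlinarith
    have e5 : 0 ≤ r ^ k := by positivity
    nlinarith
  have hα' : 0 < (n : ℝ) ^ α := Real.rpow_pos_of_pos hnpos α
  calc _ ≤ (1296 * (n : ℝ) ^ 4) * (4 * ((n : ℝ) ^ 4 * (n : ℝ) ^ α)⁻¹) := by gcongr
    _ = 5184 / (n : ℝ) ^ α := by field_simp; norm_num
    _ ≤ _ := by gcongr

/-- **Proposition.**  If `θ(p) > 0` and `α > 0`, there is a constant `c > 0` such that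
`P(ℰ(Λ(n), c ln n)) ≥ 1 - c/n^α` for every `n ≥ 2`. -/
theorem stmt_6 (p : ℝ) (hp : p ∈ Set.Icc (0 : ℝ) 1)
    (P : Measure Config) [IsProbabilityMeasure P] (hP : IsBernoulli p P)
    (hθ : 0 < theta P) (α : ℝ) (hα : 0 < α) :
    ∃ c : ℝ, 0 < c ∧ ∀ n : ℕ, 2 ≤ n →
      1 - ENNReal.ofReal c / (n : ℝ≥0∞) ^ α ≤ P (eventE n (c * Real.log n)) := by
  have hθ1 : theta P ≤ 1 := prob_le_one
  set q : ℝ≥0∞ := 1 - theta P / 24 with hq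
  have hqtop : q ≠ ⊤ := ne_top_of_le_ne_top ENNReal.one_ne_top tsub_le_self
  have h24 : theta P / 24 ≤ 1 / 2 := by
    calc theta P / 24 ≤ 1 / 24 := by gcongr
      _ ≤ 1 / 2 := by gcongr; norm_num
  have hqlt : q < 1 := by
    refine ENNReal.sub_lt_self ENNReal.one_ne_top one_ne_zero ?_
    simp [ENNReal.div_eq_zero_iff, hθ.ne']
  have hqge : 1 / 2 ≤ q := by
    calc (1 / 2 : ℝ≥0∞) = 1 - 1 / 2 := by simp [ENNReal.one_sub_inv_two]
      _ ≤ q := tsub_le_tsub_left h24 _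
  have hr1 : q.toReal < 1 := by
    have := (ENNReal.toReal_lt_toReal hqtop ENNReal.one_ne_top).2 hqlt
    simpa using this
  have hr0 : 1 / 2 ≤ q.toReal := by
    have := ENNReal.toReal_mono hqtop hqge
    simpa using this
  set c : ℝ := max 5184 ((4 + α) / (-Real.log q.toReal)) with hc
  have hc1 : 5184 ≤ c := le_max_left _ _
  refine ⟨c, by linarith, fun n hn => ?_⟩
  have hn' : (2 : ℝ) ≤ n := by exact_mod_cast hn
  have hnpos : (0 : ℝ) < n := by linarith
  have hlog : (1 / 2 : ℝ) ≤ Real.log n := by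
    have h1 := Real.log_two_gt_d9
    have h2 := Real.log_le_log (by norm_num) hn'
    linarith
  have hcl : 1 ≤ c * Real.log n := by nlinarith
  have hfl : 1 ≤ ⌊c * Real.log n⌋₊ := (Nat.one_le_floor_iff _).2 hcl
  have hbad : P (eventE n (c * Real.log n))ᶜ ≤ ENNReal.ofReal c / (n : ℝ≥0∞) ^ α := by
    refine (bad_prob hP n (⌊c * Real.log n⌋₊ - 1) _ ?_).trans ?_
    · rw [Nat.cast_sub hfl]
      have := Nat.floor_le (zero_le_one.trans hcl)
      push_cast; linarith
    · have hb := real_bound q.toReal α c hr0 hr1 hc1 (le_max_right _ _) n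
        (⌊c * Real.log n⌋₊ - 1) hn (by
          rw [Nat.cast_sub hfl]
          have := Nat.lt_floor_add_one (c * Real.log n)
          push_cast; linarith)
      have := ENNReal.ofReal_le_ofReal hb
      rw [ENNReal.ofReal_mul (by positivity), ENNReal.ofReal_natCast,
        ENNReal.ofReal_pow (by positivity), ENNReal.ofReal_toReal hqtop,
        ENNReal.ofReal_div_of_pos (Real.rpow_pos_of_pos hnpos α),
        ← ENNReal.ofReal_rpow_of_pos hnpos, ENNReal.ofReal_natCast] at this
      exact this
  rw [tsub_le_iff_right]
  calc (1 : ℝ≥0∞) = P Set.univ := measure_univ.symm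
    _ = P (eventE n (c * Real.log n) ∪ (eventE n (c * Real.log n))ᶜ) := by
        rw [Set.union_compl_self]
    _ ≤ P (eventE n (c * Real.log n)) + P (eventE n (c * Real.log n))ᶜ := measure_union_le _ _
    _ ≤ _ := by gcongr
end
end

section
/- Let c > 0. There exists a constant c′ > 0 such that for every n ≥ 1 and every percolation configuration for which the event ℰ(Λ(n), c ln n) occurs, the following holds: for every x ∈ Λ(n) ∖ Λ(n/4), there exists y ∈ Λ(n/4) with T_{Λ(n)}(x, y) ≤ c′(ln n)². -/
open MeasureTheory ENNReal

noncomputable section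

/-- `x` and `y` are joined in `box n` by a path with at most `s * N` closed sites. -/
def Reach_s7 (ω : Config) (n N s : ℕ) (x y : Site) : Prop :=
  ∃ γ : List Site, IsPathIn (box n) x y γ ∧ pathCost ω γ ≤ s * N

theorem mem_box_iff (n : ℕ) (z : Site) : z ∈ box (n : ℝ) ↔ ∀ i, |z i| ≤ (n : ℤ) := by
  unfold box
  simp only [Set.mem_setOf_eq]
  refine forall_congr' fun i => ?_
  exact_mod_cast Iff.rfl

theorem Reach_s7.trans {ω : Config} {n N s t : ℕ} {x y z : Site}
    (h : Reach_s7 ω n N s x y) (h' : Reach_s7 ω n N t y z) : Reach_s7 ω n N (s + t) x z := by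
  obtain ⟨γ, ⟨h1, h2, h3, h4⟩, h5⟩ := h
  obtain ⟨δ, ⟨k1, k2, k3, k4⟩, k5⟩ := h'
  cases δ with
  | nil => simp at k2
  | cons a δ =>
    simp only [List.head?_cons, Option.some.injEq] at k2
    subst k2
    refine ⟨γ ++ δ, ⟨?_, ?_, ?_, ?_⟩, ?_⟩
    · refine List.isChain_append.2 ⟨h1, (List.isChain_cons.1 k1).2, ?_⟩
      intro u hu v hv
      rw [h3] at hu
      simp only [Option.mem_def, Option.some.injEq] at hu
      subst hu
      exact (List.isChain_cons.1 k1).1 v hv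
    · rw [List.head?_append, h2]; rfl
    · rw [List.getLast?_append, h3]
      cases δ with
      | nil => simpa using k3
      | cons b δ =>
        rw [List.getLast?_cons_cons] at k3
        rw [k3]; rfl
    · intro u hu
      rcases List.mem_append.1 hu with hu | hu
      · exact h4 u hu
      · exact k4 u (List.mem_cons_of_mem _ hu)
    · unfold pathCost at *
      rw [List.countP_append]
      rw [List.countP_cons] at k5
      rw [add_mul]
      omega

theorem Reach_s7.mono {ω : Config} {n N s t : ℕ} {x y : Site}
    (h : Reach_s7 ω n N s x y) (hst : s ≤ t) : Reach_s7 ω n N t x y := by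
  obtain ⟨γ, h1, h2⟩ := h
  exact ⟨γ, h1, h2.trans (Nat.mul_le_mul_right _ hst)⟩

theorem Reach_s7.right_mem {ω : Config} {n N s : ℕ} {x y : Site}
    (h : Reach_s7 ω n N s x y) : ∀ i, |y i| ≤ (n : ℤ) := by
  obtain ⟨γ, ⟨_, _, h3, h4⟩, _⟩ := h
  exact (mem_box_iff n y).1 (h4 y (List.mem_of_getLast? h3))

theorem event_reach {n : ℕ} {k : ℝ} (hk : 0 ≤ k) {ω : Config} (hω : ω ∈ eventE n k)
    (x : Site) (m : ℕ) (hx : ∀ i, |x i| + m ≤ (n : ℤ)) (d : Fin 3) (ε s₁ s₂ : Bool) :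
    ∃ z ∈ faceSq m d ε s₁ s₂, Reach_s7 ω n ⌊k⌋₊ 1 x (x + z) := by
  have hsub : (x + ·) '' box (m : ℝ) ⊆ box (n : ℝ) := by
    rintro _ ⟨z, hz, rfl⟩
    rw [mem_box_iff] at hz ⊢
    intro i
    have := abs_add_le (x i) (z i)
    have := hz i
    have := hx i
    simp only [Pi.add_apply]
    omega
  have h := hω x m hsub d ε s₁ s₂
  by_contra hcon
  push Not at hcon
  have : ((⌊k⌋₊ + 1 : ℕ) : ℝ≥0∞) ≤
      travelTimeSet ω (box n) x ((x + ·) '' faceSq m d ε s₁ s₂) := by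
    unfold travelTimeSet
    refine le_iInf₂ ?_
    rintro _ ⟨z, hz, rfl⟩
    refine le_sInf ?_
    rintro _ ⟨γ, hγ, rfl⟩
    by_contra hlt
    refine hcon z hz ⟨γ, hγ, ?_⟩
    rw [not_le] at hlt
    have : pathCost ω γ < ⌊k⌋₊ + 1 := by exact_mod_cast hlt
    omega
  have h2 := this.trans h
  rw [← ENNReal.ofReal_natCast, ENNReal.ofReal_le_ofReal_iff hk] at h2
  have := Nat.lt_floor_add_one k
  push_cast at h2
  linarith

theorem site_cost {n : ℕ} {k : ℝ} (hk : 0 ≤ k) {ω : Config} (hω : ω ∈ eventE n k)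
    (x : Site) (hx : ∀ i, |x i| ≤ (n : ℤ)) : pathCost ω [x] ≤ ⌊k⌋₊ := by
  obtain ⟨z, _, γ, ⟨_, h2, _, _⟩, h5⟩ :=
    event_reach hk hω x 0 (by simpa using hx) 0 true true true
  cases γ with
  | nil => simp at h2
  | cons a γ =>
    simp only [List.head?_cons, Option.some.injEq] at h2
    subst h2
    unfold pathCost at *
    rw [List.countP_cons] at h5 ⊢
    simp only [List.countP_nil]
    omega

theorem adj_reach {n : ℕ} {k : ℝ} (hk : 0 ≤ k) {ω : Config} (hω : ω ∈ eventE n k)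
    (x y : Site) (hx : ∀ i, |x i| ≤ (n : ℤ)) (hy : ∀ i, |y i| ≤ (n : ℤ)) (h : Adj x y) :
    Reach_s7 ω n ⌊k⌋₊ 2 x y := by
  refine ⟨[x, y], ⟨?_, rfl, rfl, ?_⟩, ?_⟩
  · exact List.isChain_pair.2 h
  · intro z hz
    simp only [List.mem_cons, List.not_mem_nil, or_false] at hz
    rw [mem_box_iff]
    rcases hz with rfl | rfl <;> assumption
  · have h1 := site_cost hk hω x hx
    have h2 := site_cost hk hω y hy
    unfold pathCost at *
    simp only [List.countP_cons, List.countP_nil] at *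
    omega

theorem self_reach {n : ℕ} {k : ℝ} (hk : 0 ≤ k) {ω : Config} (hω : ω ∈ eventE n k)
    (x : Site) (hx : ∀ i, |x i| ≤ (n : ℤ)) : Reach_s7 ω n ⌊k⌋₊ 1 x x := by
  refine ⟨[x], ⟨List.isChain_singleton _, rfl, rfl, ?_⟩, ?_⟩
  · intro z hz
    simp only [List.mem_cons, List.not_mem_nil, or_false] at hz
    rw [mem_box_iff]
    subst hz
    exact hx
  · simpa using site_cost hk hω x hx

theorem abs_move (x z m : ℤ) (hz : |z| ≤ m) (h : (x ≤ 0 ∧ 0 ≤ z) ∨ (0 ≤ x ∧ z ≤ 0)) :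
    |x + z| ≤ max |x| m := by
  rw [abs_le] at hz
  rcases h with ⟨h, h'⟩ | ⟨h, h'⟩
  · rw [abs_of_nonpos h]
    exact abs_le.2 ⟨by omega, by omega⟩
  · rw [abs_of_nonneg h]
    exact abs_le.2 ⟨by omega, by omega⟩

theorem move_reach {n : ℕ} {k : ℝ} (hk : 0 ≤ k) {ω : Config} (hω : ω ∈ eventE n k)
    (x : Site) (m : ℕ) (hx : ∀ i, |x i| + m ≤ (n : ℤ)) (d : Fin 3) :
    ∃ y, Reach_s7 ω n ⌊k⌋₊ 1 x y ∧ (∀ i, |y i| ≤ max |x i| m) ∧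
      |y d| ≤ max (|x d| - m) m := by
  obtain ⟨z, ⟨hz1, hz2, hz3, hz4⟩, hr⟩ := event_reach hk hω x m hx d (decide (x d ≤ 0))
    (decide (x (others d).1 ≤ 0)) (decide (x (others d).2 ≤ 0))
  rw [mem_box_iff] at hz1
  have h0 := hz1 0
  have h1 := hz1 1
  have h2 := hz1 2
  simp only [decide_eq_true_eq] at hz2 hz3 hz4
  refine ⟨x + z, hr, ?_, ?_⟩
  · have hcase : ∀ d i : Fin 3, i = d ∨ i = (others d).1 ∨ i = (others d).2 := by
      unfold others
      decide
    intro i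
    refine abs_move _ _ _ (hz1 _) ?_
    rcases hcase d i with rfl | rfl | rfl
    · split_ifs at hz2 <;> omega
    · split_ifs at hz3 <;> omega
    · split_ifs at hz4 <;> omega
  · simp only [Pi.add_apply, hz2]
    split_ifs with h
    · rw [abs_of_nonpos h]
      exact abs_le.2 ⟨by omega, by omega⟩
    · rw [abs_of_pos (not_le.1 h)]
      exact abs_le.2 ⟨by omega, by omega⟩

theorem block_reach {n : ℕ} {k : ℝ} (hk : 0 ≤ k) {ω : Config} (hω : ω ∈ eventE n k)
    (x : Site) (m : ℕ) (R : ℤ) (hR : (m : ℤ) ≤ R) (hn : R + m ≤ n) (hx : ∀ i, |x i| ≤ R) :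
    ∃ y, Reach_s7 ω n ⌊k⌋₊ 3 x y ∧ ∀ i, |y i| ≤ max (R - m) m := by
  obtain ⟨y, r1, a1, b1⟩ := move_reach hk hω x m (fun i => by have := hx i; omega) 0
  have hy : ∀ i, |y i| ≤ R := fun i => by have := hx i; have := a1 i; omega
  obtain ⟨z, r2, a2, b2⟩ := move_reach hk hω y m (fun i => by have := hy i; omega) 1
  have hz : ∀ i, |z i| ≤ R := fun i => by have := hy i; have := a2 i; omega
  obtain ⟨w, r3, a3, b3⟩ := move_reach hk hω z m (fun i => by have := hz i; omega) 2
  refine ⟨w, (r1.trans r2).trans r3, ?_⟩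
  have := hx 0
  have := hy 1
  have := hz 2
  have := a2 0
  have := a3 0
  have := a3 1
  intro i
  fin_cases i <;> simp only [Fin.mk_zero, Fin.mk_one, Fin.reduceFinMk, Fin.isValue] <;> omega

theorem unit_move {n : ℕ} {k : ℝ} (hk : 0 ≤ k) {ω : Config} (hω : ω ∈ eventE n k)
    (x : Site) (hx : ∀ i, |x i| ≤ (n : ℤ)) (d : Fin 3) :
    ∃ y, Reach_s7 ω n ⌊k⌋₊ 2 x y ∧ (∀ i, |y i| ≤ |x i|) ∧ |y d| ≤ max (|x d| - 1) 0 := by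
  by_cases h0 : x d = 0
  · exact ⟨x, (self_reach hk hω x hx).mono (by norm_num), fun i => le_rfl, by simp [h0]⟩
  · have key : ∃ a : ℤ, |a| = |x d| - 1 ∧ |x d - a| = 1 := by
      rcases lt_or_gt_of_ne h0 with h | h
      · refine ⟨x d + 1, ?_, ?_⟩
        · rw [abs_of_nonpos (by omega), abs_of_neg h]; ring
        · simp
      · refine ⟨x d - 1, ?_, ?_⟩
        · rw [abs_of_nonneg (by omega), abs_of_pos h]
        · simp
    obtain ⟨a, ha, hb⟩ := key
    have hle : ∀ i, |Function.update x d a i| ≤ |x i| := by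
      intro i
      by_cases hi : i = d
      · subst hi; simp only [Function.update_self]; omega
      · simp [Function.update_of_ne hi]
    refine ⟨Function.update x d a, adj_reach hk hω x _ hx (fun i => (hle i).trans (hx i)) ?_,
      hle, ?_⟩
    · unfold Adj
      rw [Finset.sum_eq_single d]
      · simpa using hb
      · intro i _ hi; simp [Function.update_of_ne hi]
      · simp
    · simp only [Function.update_self]; omega

theorem unit_reach {n : ℕ} {k : ℝ} (hk : 0 ≤ k) {ω : Config} (hω : ω ∈ eventE n k)
    (x : Site) (R : ℤ) (hx : ∀ i, |x i| ≤ R) (hxn : ∀ i, |x i| ≤ (n : ℤ)) :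
    ∃ y, Reach_s7 ω n ⌊k⌋₊ 6 x y ∧ ∀ i, |y i| ≤ max (R - 1) 0 := by
  obtain ⟨y, r1, a1, b1⟩ := unit_move hk hω x hxn 0
  obtain ⟨z, r2, a2, b2⟩ := unit_move hk hω y r1.right_mem 1
  obtain ⟨w, r3, a3, b3⟩ := unit_move hk hω z r2.right_mem 2
  refine ⟨w, (r1.trans r2).trans r3, ?_⟩
  have := hx 0
  have := hx 1
  have := hx 2
  have := a1 1
  have := a1 2
  have := a2 0
  have := a2 2
  have := a3 0
  have := a3 1
  intro i
  fin_cases i <;> simp only [Fin.mk_zero, Fin.mk_one, Fin.reduceFinMk, Fin.isValue] <;> omega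

theorem doubling_reach {n : ℕ} (hn : 1 ≤ n) {k : ℝ} (hk : 0 ≤ k) {ω : Config}
    (hω : ω ∈ eventE n k) (x : Site) (hx : ∀ i, |x i| ≤ (n : ℤ)) (j : ℕ) :
    ∃ y, Reach_s7 ω n ⌊k⌋₊ (6 + 3 * j) x y ∧
      ∀ i, |y i| ≤ (n : ℤ) - (min (2 ^ j) (n / 4 + 1) : ℕ) := by
  induction j with
  | zero =>
    obtain ⟨y, hy, hy'⟩ := unit_reach hk hω x n hx hx
    refine ⟨y, hy, fun i => ?_⟩
    have := hy' i
    rw [pow_zero]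
    omega
  | succ j ih =>
    obtain ⟨y, hy, hy'⟩ := ih
    rw [pow_succ]
    by_cases h : n / 4 + 1 ≤ 2 ^ j
    · refine ⟨y, hy.mono (by omega), fun i => ?_⟩
      have := hy' i
      omega
    · obtain ⟨z, hz, hz'⟩ := block_reach hk hω y (2 ^ j) ((n : ℤ) - (2 ^ j : ℕ)) (by omega)
        (by omega) (fun i => by have := hy' i; omega)
      refine ⟨z, (hy.trans hz).mono (by omega), fun i => ?_⟩
      have := hz' i
      omega

theorem final_reach {n : ℕ} (hn : 1 ≤ n) {k : ℝ} (hk : 0 ≤ k) {ω : Config}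
    (hω : ω ∈ eventE n k) (x : Site) (hx : ∀ i, |x i| ≤ (n : ℤ)) :
    ∃ y, Reach_s7 ω n ⌊k⌋₊ (27 + 3 * Nat.log 2 n) x y ∧ ∀ i, |y i| ≤ ((n / 4 : ℕ) : ℤ) := by
  obtain ⟨y, r0, hy⟩ := doubling_reach hn hk hω x hx (Nat.log 2 n + 1)
  have hlog : n < 2 ^ (Nat.log 2 n + 1) := Nat.lt_pow_succ_log_self (by norm_num) n
  generalize 2 ^ (Nat.log 2 n + 1) = P at hy hlog
  obtain ⟨z, r1, hz⟩ := block_reach hk hω y (n / 4) ((n : ℤ) - (n / 4 : ℕ) - 1) (by omega)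
    (by omega) (fun i => by have := hy i; omega)
  obtain ⟨w, r2, hw⟩ := block_reach hk hω z (n / 4) _ (by omega) (by omega) hz
  obtain ⟨u, r3, hu⟩ := unit_reach hk hω w ((n / 4 : ℕ) + 2)
    (fun i => by have := hw i; omega) r2.right_mem
  obtain ⟨v, r4, hv⟩ := unit_reach hk hω u _ hu r3.right_mem
  refine ⟨v, ((((r0.trans r1).trans r2).trans r3).trans r4).mono (by omega), fun i => ?_⟩
  have := hv i
  omega

/-- **Proposition.**  There is a constant `c' > 0` such that, on the event
`ℰ(Λ(n), c ln n)`, every `x ∈ Λ(n) ∖ Λ(n/4)` can be joined to some `y ∈ Λ(n/4)` with a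
path in `Λ(n)` having at most `c' (ln n)²` closed sites. -/
theorem stmt_7 (c : ℝ) (hc : 0 < c) :
    ∃ c' : ℝ, 0 < c' ∧ ∀ n : ℕ, 1 ≤ n → ∀ ω ∈ eventE n (c * Real.log n),
      ∀ x ∈ box n \ box ((n : ℝ) / 4), ∃ y ∈ box ((n : ℝ) / 4),
        travelTime ω (box n) x y ≤ ENNReal.ofReal (c' * Real.log n ^ 2) := by
  have hl2 : 0 < Real.log 2 := Real.log_pos (by norm_num)
  refine ⟨30 * c / Real.log 2, by positivity, ?_⟩
  intro n hn ω hω x hx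
  have hln : 0 ≤ Real.log n := Real.log_natCast_nonneg n
  have hk : 0 ≤ c * Real.log n := by positivity
  obtain ⟨y, ⟨γ, hγ, hcost⟩, hy⟩ := final_reach hn hk hω x ((mem_box_iff n x).1 hx.1)
  refine ⟨y, ?_, ?_⟩
  · intro i
    have h1 : (|(y i : ℝ)|) ≤ ((n / 4 : ℕ) : ℝ) := by
      have h0 := (Int.cast_le (R := ℝ)).2 (hy i)
      rwa [Int.cast_abs, Int.cast_natCast] at h0
    exact h1.trans (by simpa using (Nat.cast_div_le (α := ℝ) (m := n) (n := 4)))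
  · have h0 : travelTime ω (box n) x y ≤ (pathCost ω γ : ℝ≥0∞) := sInf_le ⟨γ, hγ, rfl⟩
    refine h0.trans ?_
    rw [← ENNReal.ofReal_natCast]
    refine ENNReal.ofReal_le_ofReal ?_
    have h1 : (pathCost ω γ : ℝ) ≤ (27 + 3 * (Nat.log 2 n : ℝ)) * (⌊c * Real.log n⌋₊ : ℝ) := by
      exact_mod_cast hcost
    have h2 : (⌊c * Real.log n⌋₊ : ℝ) ≤ c * Real.log n := Nat.floor_le hk
    have h3 : (Nat.log 2 n : ℝ) ≤ Real.log n / Real.log 2 := by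
      rw [le_div_iff₀ hl2, ← Real.log_pow]
      refine Real.log_le_log (by positivity) ?_
      exact_mod_cast Nat.pow_log_le_self 2 (by omega)
    have h4 : (pathCost ω γ : ℝ) ≤ (27 + 3 * (Real.log n / Real.log 2)) * (c * Real.log n) :=
      h1.trans (by gcongr)
    refine h4.trans ?_
    rcases Nat.lt_or_ge 1 n with h | h
    · have h5 : 1 ≤ Real.log n / Real.log 2 := by
        rw [le_div_iff₀ hl2, one_mul]
        refine Real.log_le_log (by norm_num) ?_
        exact_mod_cast h
      calc (27 + 3 * (Real.log n / Real.log 2)) * (c * Real.log n)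
          ≤ (30 * (Real.log n / Real.log 2)) * (c * Real.log n) := by
            refine mul_le_mul_of_nonneg_right ?_ hk
            linarith
        _ = _ := by ring
    · have : n = 1 := by omega
      subst this
      simp
end
end
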